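/- For all t in the open interval (1, 2^{1/6}), arsinh(√(t⁶-1)) - 3·√(t⁶-1)/(α₀·t³ + 3·(1-α₀)·t + 2·α₀) < 0, where α₀ = (3 - 3·2^{1/6}·log(1+√2)) / ((2 + √2 - 3·2^{1/6})·log(1+√2)). -/

import Mathlib

noncomputable def α₀ : ℝ :=
  (3 - 3 * (2 : ℝ) ^ ((1 : ℝ)/6) * Real.log (1 + Real.sqrt 2)) /
    ((2 + Real.sqrt 2 - 3 * (2 : ℝ) ^ ((1 : ℝ)/6)) * Real.log (1 + Real.sqrt 2))

lemma log_one_add_sqrt_two_bounds :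
    0.88136 < Real.log (1 + √2) ∧ Real.log (1 + √2) < 0.88139 := by
  have hs : √2 ^ 2 = 2 := Real.sq_sqrt (by norm_num)
  have hs1 : 1.414213 < √2 := Real.lt_sqrt_of_sq_lt (by norm_num)
  have hs2 : √2 < 1.414214 := (Real.sqrt_lt' (by norm_num)).2 (by norm_num)
  have h2 : (1 + √2) ^ 2 = 3 + 2 * √2 := by linear_combination hs
  have h4 : (1 + √2) ^ 4 = 17 + 12 * √2 := by
    linear_combination ((1 + √2) ^ 2 + 3 + 2 * √2) * h2 + 4 * hs
  have h11 : (1 + √2) ^ 11 = 8119 + 5741 * √2 := by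
    have : (1 + √2) ^ 11 = ((1 + √2) ^ 4) ^ 2 * (1 + √2) ^ 2 * (1 + √2) := by ring
    rw [this, h4, h2]
    linear_combination (288 * √2 ^ 2 + 1536 * √2 + 3626) * hs
  have hlog : Real.log ((1 + √2) ^ 11 / 2 ^ 14) =
      11 * Real.log (1 + √2) - 14 * Real.log 2 := by
    rw [Real.log_div (by positivity) (by positivity), Real.log_pow, Real.log_pow]
    norm_num
  have hu := Real.log_le_sub_one_of_pos (x := (1 + √2) ^ 11 / 2 ^ 14) (by positivity)
  have hl := Real.one_sub_inv_le_log_of_pos (x := (1 + √2) ^ 11 / 2 ^ 14) (by positivity)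
  have hinv : ((1 + √2) ^ 11 / 2 ^ 14)⁻¹ < 1.009 := by
    rw [h11]
    apply inv_lt_of_inv_lt₀ (by norm_num)
    norm_num
    linarith
  rw [hlog] at hu hl
  rw [h11] at hu
  have := Real.log_two_gt_d9
  have := Real.log_two_lt_d9
  constructor <;> linarith

lemma two_rpow_one_sixth_pow_six : ((2 : ℝ) ^ ((1 : ℝ) / 6)) ^ 6 = 2 := by
  rw [← Real.rpow_natCast, ← Real.rpow_mul (by norm_num)]
  norm_num

lemma two_rpow_one_sixth_bounds :
    1.12246 < (2 : ℝ) ^ ((1 : ℝ) / 6) ∧ (2 : ℝ) ^ ((1 : ℝ) / 6) < 1.12247 := by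
  have h0 : 0 ≤ (2 : ℝ) ^ ((1 : ℝ) / 6) := by positivity
  constructor
  · apply lt_of_pow_lt_pow_left₀ 6 h0
    rw [two_rpow_one_sixth_pow_six]
    norm_num
  · apply lt_of_pow_lt_pow_left₀ 6 (by norm_num)
    rw [two_rpow_one_sixth_pow_six]
    norm_num

lemma two_rpow_one_sixth_pow_three : ((2 : ℝ) ^ ((1 : ℝ) / 6)) ^ 3 = √2 := by
  rw [eq_comm, Real.sqrt_eq_iff_mul_self_eq (by norm_num) (by positivity), ← pow_two, ← pow_mul]
  exact two_rpow_one_sixth_pow_six.symm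

lemma α₀_denom_pos :
    0 < (2 + √2 - 3 * (2 : ℝ) ^ ((1 : ℝ) / 6)) * Real.log (1 + √2) := by
  have hs1 : 1.414213 < √2 := Real.lt_sqrt_of_sq_lt (by norm_num)
  have := log_one_add_sqrt_two_bounds.1
  have := two_rpow_one_sixth_bounds.2
  apply mul_pos <;> linarith

lemma α₀_bounds : 0.7 < α₀ ∧ α₀ < 0.8 := by
  have hs1 : 1.414213 < √2 := Real.lt_sqrt_of_sq_lt (by norm_num)
  have hs2 : √2 < 1.414214 := (Real.sqrt_lt' (by norm_num)).2 (by norm_num)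
  obtain ⟨hl1, hl2⟩ := log_one_add_sqrt_two_bounds
  obtain ⟨hc1, hc2⟩ := two_rpow_one_sixth_bounds
  have hd := α₀_denom_pos
  unfold α₀
  rw [lt_div_iff₀ hd, div_lt_iff₀ hd]
  generalize (2 : ℝ) ^ ((1 : ℝ) / 6) = c at *
  generalize Real.log (1 + √2) = L at *
  generalize √2 = s at *
  constructor <;> nlinarith [mul_pos (sub_pos.2 hl1) (sub_pos.2 hc1),
    mul_pos (sub_pos.2 hl2) (sub_pos.2 hc2), mul_pos (sub_pos.2 hl1) (sub_pos.2 hs1),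
    mul_pos (sub_pos.2 hl1) (sub_pos.2 hs2)]

/-- The nontrivial factor of the numerator of the derivative of `f_a`. -/
def derivFactor (a t : ℝ) : ℝ :=
  a ^ 2 * t ^ 6 + 2 * a ^ 2 * t ^ 5 + (-6 + 12 * a - 3 * a ^ 2) * t ^ 4
    + (-12 + 18 * a - 4 * a ^ 2) * t ^ 3 + (-9 + 6 * a + 4 * a ^ 2) * t ^ 2
    + (-6 + 6 * a) * t + (-3 + 3 * a)

lemma derivFactor_pos_of_lt {a x y : ℝ} (ha : 0.7 < a) (ha' : a < 0.8) (hx : 0 < x)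
    (hxy : x < y) (h : 0 ≤ derivFactor a x) : 0 < derivFactor a y := by
  have hy : 0 < y := hx.trans hxy
  have h4 : 0 ≤ -6 + 12 * a - 3 * a ^ 2 := by nlinarith
  have h2 : 0 ≤ 9 - 6 * a - 4 * a ^ 2 := by nlinarith
  have h1 : 0 ≤ 6 - 6 * a := by linarith
  have h0 : 0 ≤ 3 - 3 * a := by linarith
  have key : ∀ z : ℝ, 0 < z → derivFactor a z / z ^ 3 =
      a ^ 2 * z ^ 3 + 2 * a ^ 2 * z ^ 2 + (-6 + 12 * a - 3 * a ^ 2) * z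
        + (-12 + 18 * a - 4 * a ^ 2) - ((9 - 6 * a - 4 * a ^ 2) / z
        + (6 - 6 * a) / z ^ 2 + (3 - 3 * a) / z ^ 3) := by
    intro z hz
    unfold derivFactor
    field_simp
    ring
  have hlt : derivFactor a x / x ^ 3 < derivFactor a y / y ^ 3 := by
    rw [key x hx, key y hy]
    have : a ^ 2 * x ^ 3 < a ^ 2 * y ^ 3 := by gcongr
    have : 2 * a ^ 2 * x ^ 2 ≤ 2 * a ^ 2 * y ^ 2 := by gcongr
    have : (-6 + 12 * a - 3 * a ^ 2) * x ≤ (-6 + 12 * a - 3 * a ^ 2) * y := by gcongr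
    have : (9 - 6 * a - 4 * a ^ 2) / y ≤ (9 - 6 * a - 4 * a ^ 2) / x := by gcongr
    have : (6 - 6 * a) / y ^ 2 ≤ (6 - 6 * a) / x ^ 2 := by gcongr
    have : (3 - 3 * a) / y ^ 3 ≤ (3 - 3 * a) / x ^ 3 := by gcongr
    linarith
  have : 0 < derivFactor a y / y ^ 3 := (by positivity : 0 ≤ _ / x ^ 3).trans_lt hlt
  exact (div_pos_iff_of_pos_right (by positivity)).1 this

lemma denom_pos {a t : ℝ} (ha : 0 < a) (ha' : a < 1) (ht : 0 < t) :
    0 < a * t ^ 3 + 3 * (1 - a) * t + 2 * a := by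
  have : 0 < 1 - a := sub_pos.2 ha'
  positivity

lemma hasDerivAt_arsinh_sub {a t : ℝ} (ha : 0 < a) (ha' : a < 1) (ht : 1 < t) :
    HasDerivAt (fun t : ℝ ↦ Real.arsinh √(t ^ 6 - 1) -
        3 * √(t ^ 6 - 1) / (a * t ^ 3 + 3 * (1 - a) * t + 2 * a))
      (3 * (t - 1) ^ 2 / (√(t ^ 6 - 1) * (a * t ^ 3 + 3 * (1 - a) * t + 2 * a) ^ 2)
        * derivFactor a t) t := by
  have ht0 : 0 < t := by linarith
  have hD := denom_pos ha ha' ht0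
  have hr : 0 < t ^ 6 - 1 := sub_pos.2 (one_lt_pow₀ ht (by norm_num))
  have hs : 0 < √(t ^ 6 - 1) := Real.sqrt_pos.2 hr
  have hsq : √(t ^ 6 - 1) ^ 2 = t ^ 6 - 1 := Real.sq_sqrt hr.le
  have h1 : HasDerivAt (fun t : ℝ ↦ √(t ^ 6 - 1)) (6 * t ^ 5 / (2 * √(t ^ 6 - 1))) t := by
    have := ((hasDerivAt_pow 6 t).sub_const 1).sqrt hr.ne'
    simpa using this
  have h2 : HasDerivAt (fun t : ℝ ↦ a * t ^ 3 + 3 * (1 - a) * t + 2 * a)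
      (a * (3 * t ^ 2) + 3 * (1 - a)) t := by
    have := (((hasDerivAt_pow 3 t).const_mul a).add
      ((hasDerivAt_id t).const_mul (3 * (1 - a)))).add_const (2 * a)
    simpa using this
  have h3 := h1.arsinh.sub ((h1.const_mul 3).div h2 hD.ne')
  have hroot : √(1 + √(t ^ 6 - 1) ^ 2) = t ^ 3 := by
    rw [hsq, show 1 + (t ^ 6 - 1) = (t ^ 3) ^ 2 by ring, Real.sqrt_sq (by positivity)]
  refine h3.congr_deriv ?_
  rw [hroot, smul_eq_mul]
  unfold derivFactor
  generalize √(t ^ 6 - 1) = s at *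
  set D := a * t ^ 3 + 3 * (1 - a) * t + 2 * a with hDdef
  field_simp
  rw [hsq, hDdef]
  ring

theorem stmt_9 (t : ℝ) (ht : t ∈ Set.Ioo 1 ((2 : ℝ) ^ ((1 : ℝ)/6))) :
    Real.arsinh (Real.sqrt (t ^ 6 - 1)) -
      3 * Real.sqrt (t ^ 6 - 1) / (α₀ * t ^ 3 + 3 * (1 - α₀) * t + 2 * α₀) < 0 := by
  obtain ⟨ha, ha'⟩ := α₀_bounds
  have ha0 : 0 < α₀ := by linarith
  have ha1 : α₀ < 1 := by linarith
  set f : ℝ → ℝ := fun t ↦ Real.arsinh √(t ^ 6 - 1) -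
    3 * √(t ^ 6 - 1) / (α₀ * t ^ 3 + 3 * (1 - α₀) * t + 2 * α₀) with hf
  have hf1 : f 1 = 0 := by simp [hf]
  have hfc : f ((2 : ℝ) ^ ((1 : ℝ) / 6)) = 0 := by
    have hL : 0 < Real.log (1 + √2) := by linarith [log_one_add_sqrt_two_bounds.1]
    have hd := α₀_denom_pos
    have hD : α₀ * √2 + 3 * (1 - α₀) * (2 : ℝ) ^ ((1 : ℝ) / 6) + 2 * α₀
        = 3 / Real.log (1 + √2) := by
      have h : α₀ * ((2 + √2 - 3 * (2 : ℝ) ^ ((1 : ℝ) / 6)) * Real.log (1 + √2)) =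
          3 - 3 * (2 : ℝ) ^ ((1 : ℝ) / 6) * Real.log (1 + √2) := div_mul_cancel₀ _ hd.ne'
      rw [eq_div_iff hL.ne']
      linear_combination h
    simp only [hf]
    rw [two_rpow_one_sixth_pow_six, two_rpow_one_sixth_pow_three, hD,
      show (2 : ℝ) - 1 = 1 by norm_num, Real.sqrt_one, Real.arsinh,
      show (1 : ℝ) + 1 ^ 2 = 2 by norm_num]
    field_simp
    ring
  have hcont : ContinuousOn f (Set.Ici 1) := by
    apply ContinuousOn.sub
    · exact (Real.continuous_arsinh.comp (by fun_prop)).continuousOn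
    · exact ContinuousOn.div (by fun_prop) (by fun_prop) fun x hx ↦
        (denom_pos ha0 ha1 (zero_lt_one.trans_le hx)).ne'
  have hcoef : ∀ x : ℝ, 1 < x → 0 < 3 * (x - 1) ^ 2 /
      (√(x ^ 6 - 1) * (α₀ * x ^ 3 + 3 * (1 - α₀) * x + 2 * α₀) ^ 2) := by
    intro x hx
    have := denom_pos ha0 ha1 (zero_lt_one.trans hx)
    have : 0 < √(x ^ 6 - 1) := Real.sqrt_pos.2 (sub_pos.2 (one_lt_pow₀ hx (by norm_num)))
    have : 0 < x - 1 := sub_pos.2 hx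
    positivity
  by_contra! hft
  change 0 ≤ f t at hft
  obtain ⟨x, hx, hxd⟩ := exists_hasDerivAt_eq_slope f _ ht.1
    (hcont.mono Set.Icc_subset_Ici_self) fun x hx ↦ hasDerivAt_arsinh_sub ha0 ha1 hx.1
  obtain ⟨y, hy, hyd⟩ := exists_hasDerivAt_eq_slope f _ ht.2
    (hcont.mono fun z hz ↦ ht.1.le.trans hz.1) fun x hx ↦
      hasDerivAt_arsinh_sub ha0 ha1 (ht.1.trans hx.1)
  have hQx : 0 ≤ derivFactor α₀ x := by
    rw [← mul_nonneg_iff_of_pos_left (hcoef x hx.1)]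
    rw [hxd, hf1, sub_zero]
    exact div_nonneg hft (sub_pos.2 ht.1).le
  have hQy : 0 < derivFactor α₀ y :=
    derivFactor_pos_of_lt ha ha' (zero_lt_one.trans hx.1) (hx.2.trans hy.1) hQx
  have := mul_pos (hcoef y (ht.1.trans hy.1)) hQy
  rw [hyd, hfc, zero_sub] at this
  exact this.not_ge (div_nonpos_of_nonpos_of_nonneg (by linarith) (sub_pos.2 ht.2).le)
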